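/- Let d ≥ 4 and let P ⊂ ℝ^d be a d-dimensional canonical lattice simplex. Then Vol(P) ≤ 2·(s_d − 1)², with equality if and only if P is unimodularly equivalent to conv{0, s_1 e_1, …, s_{d-1} e_{d-1}, 2(s_d − 1) e_d} − (1, …, 1). -/

import Mathlib

/-- Shifted Sylvester sequence: `sylv n` is the Sylvester number `s (n+1)`,
so `sylv 0 = s 1 = 2`, `sylv 1 = s 2 = 3`, `sylv 2 = s 3 = 7`, `sylv 3 = s 4 = 43`, …
It satisfies `s (i+1) = s i * (s i - 1) + 1 = s 1 * ⋯ * s i + 1`. -/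
def sylv : ℕ → ℕ
  | 0 => 2
  | n + 1 => sylv n * (sylv n - 1) + 1

/-- The canonical embedding of integer vectors into real vectors. -/
def toR {d : ℕ} (x : Fin d → ℤ) : Fin d → ℝ := fun j => (x j : ℝ)

/-- The lattice simplex (as a subset of `ℝ^d`) with vertex family `v`. -/
def hullOf {d : ℕ} (v : Fin (d + 1) → Fin d → ℤ) : Set (Fin d → ℝ) :=
  convexHull ℝ (Set.range fun i => toR (v i))

/-- `v` is the vertex family of a `d`-dimensional canonical lattice simplex:
the vertices are affinely independent lattice points, the origin lies in the
interior, and the origin is the only lattice point in the interior. -/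
def IsCanonicalSimplex {d : ℕ} (v : Fin (d + 1) → Fin d → ℤ) : Prop :=
  AffineIndependent ℝ (fun i => toR (v i)) ∧
  (0 : Fin d → ℝ) ∈ interior (hullOf v) ∧
  ∀ x : Fin d → ℤ, toR x ∈ interior (hullOf v) → x = 0

/-- Two subsets of `ℝ^d` are unimodularly equivalent if one is the image of the
other under `x ↦ A x + w` with `A ∈ GL_d(ℤ)` and `w ∈ ℤ^d`. -/
def UnimodEquiv {d : ℕ} (Q Q' : Set (Fin d → ℝ)) : Prop :=
  ∃ (A : Matrix (Fin d) (Fin d) ℤ) (w : Fin d → ℤ), IsUnit A.det ∧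
    Q' = (fun x => (A.map fun n : ℤ => (n : ℝ)).mulVec x + toR w) '' Q

/-- The vertex family of the simplex
`conv{0, s_1 e_1, …, s_{d-1} e_{d-1}, 2(s_d - 1) e_d} - (1,…,1)`. -/
def volMaxV (d : ℕ) : Fin (d + 1) → Fin d → ℤ := fun i j =>
  (if (j : ℕ) + 1 = (i : ℕ) then
      (if (i : ℕ) ≤ d - 1 then (sylv ((i : ℕ) - 1) : ℤ)
       else 2 * ((sylv (d - 1) : ℤ) - 1))
    else 0) - 1

open Finset in
lemma sum_range_mul_sub_mul (a c : ℕ → ℝ) (k : ℕ) :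
    ∑ i ∈ range k, a i * c i =
      ∑ i ∈ range k, (∑ l ∈ range (i + 1), a l) * (c i - c (i + 1)) + (∑ l ∈ range k, a l) * c k := by
  induction k with
  | zero => simp
  | succ k ih => rw [sum_range_succ, ih, sum_range_succ _ k, sum_range_succ a k]; ring

lemma two_le_sylv (n : ℕ) : 2 ≤ sylv n := by
  induction n with
  | zero => simp [sylv]
  | succ n ih =>
    rw [sylv]
    have : 1 ≤ sylv n - 1 := by omega
    nlinarith

/-- The product `s_1 ⋯ s_k = s_{k+1} - 1`. -/
noncomputable def sylvProd (k : ℕ) : ℝ := (sylv k : ℝ) - 1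

lemma sylvProd_zero : sylvProd 0 = 1 := by norm_num [sylvProd, sylv]

lemma cast_sylv (k : ℕ) : (sylv k : ℝ) = sylvProd k + 1 := by simp [sylvProd]

lemma sylvProd_succ (k : ℕ) : sylvProd (k + 1) = sylvProd k * (sylvProd k + 1) := by
  have h := two_le_sylv k
  simp only [sylvProd, sylv]
  push_cast [Nat.cast_sub (by omega : 1 ≤ sylv k)]
  ring

lemma one_le_sylvProd (k : ℕ) : 1 ≤ sylvProd k := by
  have h : (2 : ℝ) ≤ sylv k := by exact_mod_cast two_le_sylv k
  simp only [sylvProd]; linarith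

lemma sylvProd_mono : Monotone sylvProd := by
  refine monotone_nat_of_le_succ fun k => ?_
  have := one_le_sylvProd k
  rw [sylvProd_succ]; nlinarith

lemma two_le_sylvProd {k : ℕ} (hk : 1 ≤ k) : 2 ≤ sylvProd k := by
  refine le_trans (le_of_eq ?_) (sylvProd_mono hk)
  rw [sylvProd_succ, sylvProd_zero]; norm_num

lemma six_le_sylvProd {k : ℕ} (hk : 2 ≤ k) : 6 ≤ sylvProd k := by
  refine le_trans (le_of_eq ?_) (sylvProd_mono hk)
  rw [sylvProd_succ, sylvProd_succ, sylvProd_zero]; norm_num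

open Finset in
lemma prod_sylv (k : ℕ) : ∏ i ∈ range k, (sylv i : ℝ) = sylvProd k := by
  induction k with
  | zero => simp [sylvProd_zero]
  | succ k ih => rw [prod_range_succ, ih, cast_sylv, sylvProd_succ]

open Finset in
lemma sum_inv_sylv (k : ℕ) : ∑ i ∈ range k, (1 / (sylv i : ℝ)) = 1 - 1 / sylvProd k := by
  induction k with
  | zero => simp [sylvProd_zero]
  | succ k ih =>
    have := one_le_sylvProd k
    rw [sum_range_succ, ih, cast_sylv, sylvProd_succ]
    field_simp
    ring

/-- Barycentric coordinates sorted decreasingly and satisfying the product-sum inequalities. -/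
structure ProductSum (n : ℕ) (x : ℕ → ℝ) : Prop where
  pos : ∀ i < n, 0 < x i
  anti : ∀ i, i + 1 < n → x (i + 1) ≤ x i
  sum_eq : ∑ i ∈ Finset.range n, x i = 1
  prod_le : ∀ k, 1 ≤ k → k < n →
    ∏ i ∈ Finset.range k, x i ≤ 1 - ∑ i ∈ Finset.range k, x i

namespace ProductSum

open Finset

variable {n : ℕ} {x : ℕ → ℝ}

lemma prod_pos (h : ProductSum n x) {k : ℕ} (hk : k ≤ n) : 0 < ∏ i ∈ range k, x i :=
  Finset.prod_pos fun i hi => h.pos i (lt_of_lt_of_le (mem_range.1 hi) hk)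

/-- The tails of `x` are at least those of the Sylvester sequence. -/
lemma tail_ge (h : ProductSum n x) (k : ℕ) (hk : k < n) :
    1 / sylvProd k ≤ 1 - ∑ i ∈ range k, x i := by
  induction k using Nat.strong_induction_on with
  | _ k ih =>
    rcases Nat.eq_zero_or_pos k with rfl | hk0
    · simp [sylvProd_zero]
    by_contra! hlt
    have hp := h.prod_le k hk0 hk
    have hN := one_le_sylvProd k
    have hsy : ∀ i, (0 : ℝ) < sylv i := fun i => by
      exact_mod_cast lt_of_lt_of_le two_pos (two_le_sylv i)
    have hx : ∀ i ∈ range k, 0 < x i := fun i hi => h.pos i (by have := mem_range.1 hi; omega)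
    have hlog : 0 < ∑ i ∈ range k, Real.log (1 / sylv i / x i) := by
      rw [← Real.log_prod (fun i hi => (div_pos (one_div_pos.2 (hsy i)) (hx i hi)).ne')]
      apply Real.log_pos
      rw [prod_div_distrib, prod_div_distrib, prod_sylv, prod_const_one,
        lt_div_iff₀ (h.prod_pos hk.le), one_mul]
      exact lt_of_le_of_lt hp hlt
    have hle : ∑ i ∈ range k, Real.log (1 / sylv i / x i)
        ≤ ∑ i ∈ range k, (1 / (sylv i : ℝ) - x i) * (x i)⁻¹ := by
      refine sum_le_sum fun i hi => ?_
      have h1 := Real.log_le_sub_one_of_pos (div_pos (one_div_pos.2 (hsy i)) (hx i hi))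
      have := (hx i hi).ne'
      calc _ ≤ _ := h1
        _ = _ := by field_simp
    have hD : ∀ j, ∑ l ∈ range j, (1 / (sylv l : ℝ) - x l)
        = (1 - ∑ l ∈ range j, x l) - 1 / sylvProd j := fun j => by
      rw [sum_sub_distrib, sum_inv_sylv]; ring
    obtain ⟨m, rfl⟩ : ∃ m, k = m + 1 := ⟨k - 1, by omega⟩
    replace hle := hle.trans_eq (sum_range_succ _ m)
    have hab := sum_range_mul_sub_mul (fun i => 1 / (sylv i : ℝ) - x i) (fun i => (x i)⁻¹) m
    have hneg : ∑ i ∈ range m, (∑ l ∈ range (i + 1), (1 / (sylv l : ℝ) - x l)) *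
        ((x i)⁻¹ - (x (i + 1))⁻¹) ≤ 0 := by
      refine sum_nonpos fun i hi => ?_
      have hi' := mem_range.1 hi
      refine mul_nonpos_of_nonneg_of_nonpos ?_ ?_
      · rw [hD]; linarith [ih (i + 1) (by omega) (by omega)]
      · rw [sub_nonpos]
        exact inv_anti₀ (h.pos _ (by omega)) (h.anti i (by omega))
    have hlast : ∑ l ∈ range (m + 1), (1 / (sylv l : ℝ) - x l) < 0 := by
      rw [hD]; linarith
    rw [sum_range_succ] at hlast
    have hxm : 0 < (x m)⁻¹ := inv_pos.2 (h.pos m (by omega))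
    have := mul_neg_of_neg_of_pos hlast hxm
    nlinarith

/-- Linearised comparison with the Sylvester sequence, the tail being weighted by `m`. -/
lemma sum_div_sub_one_le (h : ProductSum n x) {k m : ℕ} (hk : k + 1 < n)
    (hgood : 1 - ∑ i ∈ range (k + 1), x i ≤ m * x k) :
    ∑ i ∈ range (k + 1), (1 / sylv i / x i - 1) +
      m * (1 / sylvProd (k + 1) / (1 - ∑ i ∈ range (k + 1), x i) - 1) ≤ 0 := by
  have hD : ∀ j, ∑ l ∈ range j, (1 / (sylv l : ℝ) - x l)
      = (1 - ∑ l ∈ range j, x l) - 1 / sylvProd j := fun j => by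
    rw [sum_sub_distrib, sum_inv_sylv]; ring
  have hsum : ∑ i ∈ range (k + 1), (1 / sylv i / x i - 1)
      = ∑ i ∈ range (k + 1), (1 / (sylv i : ℝ) - x i) * (x i)⁻¹ := by
    refine sum_congr rfl fun i hi => ?_
    have := (h.pos i (by have := mem_range.1 hi; omega)).ne'
    field_simp
  have hneg : ∑ i ∈ range k, (∑ l ∈ range (i + 1), (1 / (sylv l : ℝ) - x l)) *
      ((x i)⁻¹ - (x (i + 1))⁻¹) ≤ 0 := by
    refine sum_nonpos fun i hi => ?_
    have hi' := mem_range.1 hi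
    refine mul_nonpos_of_nonneg_of_nonpos ?_ ?_
    · rw [hD]; linarith [h.tail_ge (i + 1) (by omega)]
    · rw [sub_nonpos]
      exact inv_anti₀ (h.pos _ (by omega)) (h.anti i (by omega))
  have hab := sum_range_mul_sub_mul (fun i => 1 / (sylv i : ℝ) - x i) (fun i => (x i)⁻¹) k
  have htail := h.tail_ge (k + 1) hk
  have hDk := hD (k + 1)
  rw [sum_range_succ] at hDk
  rw [hsum, sum_range_succ, hab]
  set τ := 1 - ∑ i ∈ range (k + 1), x i with hτ
  have hτ0 : 0 < τ := lt_of_lt_of_le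
    (one_div_pos.2 (by linarith [one_le_sylvProd (k + 1)])) htail
  have hxk := h.pos k (by omega)
  have hmτ : (x k)⁻¹ ≤ m / τ := by
    rw [inv_eq_one_div, div_le_div_iff₀ hxk hτ0]; linarith
  have e1 : (m : ℝ) * (1 / sylvProd (k + 1) / τ - 1) = -((τ - 1 / sylvProd (k + 1)) * (m / τ)) := by
    field_simp; ring
  have := mul_le_mul_of_nonneg_left hmτ (sub_nonneg.2 htail)
  rw [e1]
  rw [← hDk] at this ⊢
  linarith

lemma tail_pos (h : ProductSum n x) {k : ℕ} (hk : k < n) : 0 < 1 - ∑ i ∈ range k, x i :=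
  lt_of_lt_of_le (one_div_pos.2 (by linarith [one_le_sylvProd k])) (h.tail_ge k hk)

lemma log_ratio (h : ProductSum n x) {k m : ℕ} (hk : k < n) :
    ∑ i ∈ range k, Real.log (1 / sylv i / x i) +
      m * Real.log (1 / sylvProd k / (1 - ∑ i ∈ range k, x i)) =
    Real.log (1 / sylvProd k ^ (m + 1)) -
      Real.log ((∏ i ∈ range k, x i) * (1 - ∑ i ∈ range k, x i) ^ m) := by
  have hsy : ∀ i, (0 : ℝ) < sylv i := fun i => by
    exact_mod_cast lt_of_lt_of_le two_pos (two_le_sylv i)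
  have hx : ∀ i ∈ range k, 0 < x i := fun i hi => h.pos i (by have := mem_range.1 hi; omega)
  have hM : 0 < sylvProd k := by linarith [one_le_sylvProd k]
  have hp := h.prod_pos hk.le
  have ht := h.tail_pos hk
  rw [← Real.log_prod (fun i hi => (div_pos (one_div_pos.2 (hsy i)) (hx i hi)).ne'),
    prod_div_distrib, prod_div_distrib, prod_sylv, prod_const_one,
    Real.log_mul hp.ne' (by positivity), Real.log_div (by positivity) hp.ne',
    Real.log_div (by positivity) ht.ne']
  simp only [one_div, Real.log_inv, Real.log_pow]
  push_cast
  ring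

lemma one_div_le_prod_mul_tail (h : ProductSum n x) {k m : ℕ} (hk : k + 1 < n)
    (hgood : 1 - ∑ i ∈ range (k + 1), x i ≤ m * x k) :
    1 / sylvProd (k + 1) ^ (m + 1) ≤
      (∏ i ∈ range (k + 1), x i) * (1 - ∑ i ∈ range (k + 1), x i) ^ m := by
  have hsy : ∀ i, (0 : ℝ) < sylv i := fun i => by
    exact_mod_cast lt_of_lt_of_le two_pos (two_le_sylv i)
  have hx : ∀ i ∈ range (k + 1), 0 < x i := fun i hi =>
    h.pos i (by have := mem_range.1 hi; omega)
  have hM : 0 < sylvProd (k + 1) := by linarith [one_le_sylvProd (k + 1)]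
  have hp := h.prod_pos hk.le
  have ht := h.tail_pos hk
  rw [← Real.log_le_log_iff (by positivity) (by positivity), ← sub_nonpos, ← h.log_ratio hk]
  refine le_trans (add_le_add (sum_le_sum fun i hi => ?_) ?_) (h.sum_div_sub_one_le hk hgood)
  · exact Real.log_le_sub_one_of_pos (div_pos (one_div_pos.2 (hsy i)) (hx i hi))
  · exact mul_le_mul_of_nonneg_left (Real.log_le_sub_one_of_pos (by positivity)) (by positivity)

lemma eq_of_prod_mul_tail_le (h : ProductSum n x) {k m : ℕ} (hk : k + 1 < n)
    (hgood : 1 - ∑ i ∈ range (k + 1), x i ≤ m * x k)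
    (hle : (∏ i ∈ range (k + 1), x i) * (1 - ∑ i ∈ range (k + 1), x i) ^ m ≤
      1 / sylvProd (k + 1) ^ (m + 1)) :
    ∀ i < k + 1, x i = 1 / sylv i := by
  have hsy : ∀ i, (0 : ℝ) < sylv i := fun i => by
    exact_mod_cast lt_of_lt_of_le two_pos (two_le_sylv i)
  have hx : ∀ i ∈ range (k + 1), 0 < x i := fun i hi =>
    h.pos i (by have := mem_range.1 hi; omega)
  have hM : 0 < sylvProd (k + 1) := by linarith [one_le_sylvProd (k + 1)]
  have hp := h.prod_pos hk.le
  have ht := h.tail_pos hk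
  rw [← Real.log_le_log_iff (by positivity) (by positivity), ← sub_nonneg, ← h.log_ratio hk] at hle
  intro i hi
  by_contra hne
  have hlt : ∑ i ∈ range (k + 1), Real.log (1 / sylv i / x i) <
      ∑ i ∈ range (k + 1), (1 / sylv i / x i - 1) := by
    refine sum_lt_sum (fun i hi =>
      Real.log_le_sub_one_of_pos (div_pos (one_div_pos.2 (hsy i)) (hx i hi)))
      ⟨i, mem_range.2 hi, Real.log_lt_sub_one_of_pos
        (div_pos (one_div_pos.2 (hsy i)) (hx i (mem_range.2 hi))) fun h1 => hne ?_⟩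
    rw [div_eq_one_iff_eq (hx i (mem_range.2 hi)).ne'] at h1
    exact h1.symm
  have h2 : (m : ℝ) * Real.log (1 / sylvProd (k + 1) / (1 - ∑ i ∈ range (k + 1), x i)) ≤
      m * (1 / sylvProd (k + 1) / (1 - ∑ i ∈ range (k + 1), x i) - 1) :=
    mul_le_mul_of_nonneg_left (Real.log_le_sub_one_of_pos (by positivity)) (by positivity)
  linarith [h.sum_div_sub_one_le hk hgood]

lemma tail_le (h : ProductSum n x) {k m : ℕ} (hkm : k + 1 + m = n) :
    1 - ∑ i ∈ range (k + 1), x i ≤ m * x k := by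
  have hanti : ∀ j, k + j < n → x (k + j) ≤ x k := fun j => by
    induction j with
    | zero => simp
    | succ j ih => exact fun hj => (h.anti (k + j) (by omega)).trans (ih (by omega))
  have hs := h.sum_eq
  rw [← hkm, sum_range_add] at hs
  have : ∑ j ∈ range m, x (k + 1 + j) ≤ ∑ _j ∈ range m, x k := by
    refine sum_le_sum fun j hj => ?_
    have := mem_range.1 hj
    rw [add_assoc, add_comm 1 j]
    exact hanti (j + 1) (by omega)
  rw [sum_const, card_range, nsmul_eq_mul] at this
  linarith

end ProductSum

lemma pow_div_le_mul_pow_div {a t : ℝ} {m : ℕ} (ha : 0 < a) (h1 : m * a ≤ t)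
    (h2 : t ≤ (m + 1) * a) :
    ((a + t) / (m + 2)) ^ (m + 1) ≤ a * (t / (m + 1)) ^ m := by
  obtain ⟨u, rfl⟩ : ∃ u, t = (m + 1) * a - u := ⟨(m + 1) * a - t, by ring⟩
  have hu : 0 ≤ u := by linarith
  have hu' : u ≤ a := by linarith
  have hm : (0 : ℝ) ≤ m := m.cast_nonneg
  have eA : (a + ((m + 1) * a - u)) / (m + 2 : ℝ) = a - u / (m + 2) := by field_simp; ring
  have eB : ((m + 1) * a - u) / (m + 1 : ℝ) = a - u / (m + 1) := by field_simp
  rw [eA, eB]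
  have hu2 : u / (m + 2) < a := by
    rw [div_lt_iff₀ (by positivity)]; nlinarith
  have hu1 : 0 ≤ a - u / (m + 1) := by
    rw [sub_nonneg, div_le_iff₀ (by positivity)]; nlinarith
  set A := a - u / (m + 2) with hA
  set B := a - u / (m + 1) with hB
  have hA0 : 0 < A := by linarith
  have hbern := one_add_mul_le_pow (a := B / A - 1)
    (by linarith [div_nonneg hu1 hA0.le]) m
  rw [add_sub_cancel, div_pow, le_div_iff₀ (by positivity)] at hbern
  have key : A * A ≤ a * (A + m * (B - A)) := by
    have : a * (A + m * (B - A)) - A * A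
        = u * (a * (m + 2) - u * (m + 1)) / ((m + 1) * (m + 2) ^ 2) := by
      rw [hA, hB]; field_simp; ring
    have h3 : 0 ≤ a * (m + 2) - u * (m + 1) := by nlinarith
    have : 0 ≤ u * (a * (m + 2) - u * (m + 1)) / ((m + 1) * (m + 2 : ℝ) ^ 2) := by positivity
    linarith
  have key' : A ≤ a * (1 + m * (B / A - 1)) := by
    have : a * (1 + m * (B / A - 1)) = a * (A + m * (B - A)) / A := by field_simp
    rw [this, le_div_iff₀ hA0]; exact key
  calc A ^ (m + 1) = A * A ^ m := by ring
    _ ≤ a * (1 + m * (B / A - 1)) * A ^ m := by gcongr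
    _ = a * ((1 + m * (B / A - 1)) * A ^ m) := by ring
    _ ≤ a * B ^ m := by gcongr

lemma succ_pow_lt_three_mul_pow (m : ℕ) (hm : 1 ≤ m) : ((m : ℝ) + 1) ^ m < 3 * (m : ℝ) ^ m := by
  have hm' : (0 : ℝ) < m := by exact_mod_cast hm
  have h1 : (1 + 1 / (m : ℝ)) ^ m ≤ Real.exp 1 := by
    calc (1 + 1 / (m : ℝ)) ^ m ≤ (Real.exp (1 / m)) ^ m := by
          gcongr; linarith [Real.add_one_le_exp (1 / (m : ℝ))]
      _ = Real.exp 1 := by rw [← Real.exp_nat_mul]; congr 1; field_simp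
  have h2 := Real.exp_one_lt_d9
  have h3 : ((m : ℝ) + 1) ^ m = (1 + 1 / (m : ℝ)) ^ m * (m : ℝ) ^ m := by
    rw [← mul_pow]; congr 1; field_simp
  rw [h3]
  have : (0 : ℝ) < (m : ℝ) ^ m := by positivity
  nlinarith

lemma four_mul_le_two_pow (m : ℕ) (hm : 4 ≤ m) : 4 * m ≤ 2 ^ m := by
  induction m, hm using Nat.le_induction with
  | base => norm_num
  | succ m hm ih => rw [pow_succ]; omega

lemma three_mul_le_three_pow (m : ℕ) (hm : 2 ≤ m) : 3 * (m + 1) ≤ 3 ^ m := by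
  induction m, hm using Nat.le_induction with
  | base => norm_num
  | succ m hm ih => rw [pow_succ]; omega

lemma three_mul_mul_le_pow {k m : ℕ} (hm : 2 ≤ m) (hkm : 4 ≤ k + m) (h : m = 2 → 6 ≤ sylvProd k) :
    3 * m * sylvProd k ≤ (sylvProd k + 1) ^ m := by
  rcases Nat.eq_zero_or_pos k with rfl | hk
  · rw [sylvProd_zero]
    have : (4 * m : ℝ) ≤ 2 ^ m := by exact_mod_cast four_mul_le_two_pow m (by omega)
    norm_num
    have : (0 : ℝ) ≤ m := m.cast_nonneg
    linarith
  have hN := two_le_sylvProd hk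
  rcases hm.lt_or_eq with hm3 | rfl
  · obtain ⟨j, rfl⟩ : ∃ j, m = j + 1 := ⟨m - 1, by omega⟩
    have h3 : (3 * ((j : ℝ) + 1)) ≤ 3 ^ j := by exact_mod_cast three_mul_le_three_pow j (by omega)
    have h4 : (3 : ℝ) ^ j ≤ (sylvProd k + 1) ^ j := by gcongr; linarith
    have h5 := h3.trans h4
    rw [pow_succ]
    push_cast
    calc 3 * ((j : ℝ) + 1) * sylvProd k ≤ (sylvProd k + 1) ^ j * sylvProd k := by gcongr
      _ ≤ _ := by gcongr; linarith
  · have := h rfl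
    norm_num
    nlinarith

/-- The value of the objective at the point with Sylvester head of length `k` and constant tail
of length `m + 1`. -/
noncomputable def headTail (k m : ℕ) : ℝ := 1 / ((m + 1) ^ m * sylvProd k ^ (m + 1))

lemma headTail_succ_lt {k m : ℕ} (hm : 1 ≤ m) (hkm : 4 ≤ k + (m + 1)) :
    headTail (k + 1) m < headTail k (m + 1) := by
  have hN := one_le_sylvProd k
  have h1 := three_mul_mul_le_pow (k := k) (m := m + 1) (by omega) hkm
    (fun h => six_le_sylvProd (by omega))
  have h2 := succ_pow_lt_three_mul_pow (m + 1) (by omega)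
  unfold headTail
  rw [sylvProd_succ, mul_pow]
  set N := sylvProd k
  apply one_div_lt_one_div_of_lt (by positivity)
  push_cast at *
  have e : ((m : ℝ) + 1 + 1) ^ (m + 1) * N ^ (m + 1 + 1) =
    (((m : ℝ) + 1 + 1) ^ (m + 1)) * N * N ^ (m + 1) := by ring
  have e' : (3 * ((m : ℝ) + 1) ^ (m + 1)) * N * N ^ (m + 1) =
    (m + 1) ^ m * (N ^ (m + 1) * (3 * (m + 1) * N)) := by ring
  rw [e]
  calc _ < (3 * ((m : ℝ) + 1) ^ (m + 1)) * N * N ^ (m + 1) := by gcongr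
    _ = _ := e'
    _ ≤ _ := by gcongr

lemma headTail_lt {d k m : ℕ} (hd : 4 ≤ d) (hm : 1 ≤ m) (hkm : k + m + 1 = d) :
    headTail (d - 1) 1 < headTail k (m + 1) := by
  induction m generalizing k with
  | zero => omega
  | succ m ih =>
    rcases Nat.eq_zero_or_pos m with rfl | h0
    · obtain rfl : d = k + 2 := by omega
      exact headTail_succ_lt (by omega) (by omega)
    · exact (ih (k := k + 1) h0 (by omega)).trans (headTail_succ_lt (by omega) (by omega))

namespace ProductSum

open Finset

variable {d : ℕ} {x : ℕ → ℝ}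

lemma headTail_lt_prod (h : ProductSum (d + 1) x) (hd : 4 ≤ d) (k m : ℕ) (hm : 1 ≤ m)
    (hkm : k + m + 1 = d) :
    headTail (d - 1) 1 <
      (∏ i ∈ range k, x i) * ((1 - ∑ i ∈ range k, x i) / (m + 2)) ^ (m + 1) := by
  induction k generalizing m with
  | zero =>
    refine (headTail_lt hd hm hkm).trans_le (le_of_eq ?_)
    simp only [headTail, sylvProd_zero, range_zero, prod_empty, sum_empty]
    push_cast
    norm_num
    ring
  | succ k ih =>
    rcases le_total (1 - ∑ i ∈ range (k + 1), x i) ((m + 1 : ℕ) * x k) with hg | hb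
    · refine (headTail_lt hd hm hkm).trans_le ?_
      have := h.one_div_le_prod_mul_tail (by omega) hg
      have e : headTail (k + 1) (m + 1) = 1 / sylvProd (k + 1) ^ (m + 1 + 1) / (m + 2) ^ (m + 1) := by
        rw [headTail, div_div]; push_cast; congr 1; ring
      rw [e, div_pow, ← mul_div_assoc]
      gcongr
    · refine (ih (m + 1) (by omega) (by omega)).trans_le ?_
      have hle := h.tail_le (k := k) (m := m + 2) (by omega)
      have := pow_div_le_mul_pow_div (m := m + 1) (h.pos k (by omega)) hb (by
        push_cast at hle ⊢; linarith)
      have e : x k + (1 - ∑ i ∈ range (k + 1), x i) = 1 - ∑ i ∈ range k, x i := by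
        rw [sum_range_succ]; ring
      rw [e] at this
      rw [prod_range_succ, mul_assoc]
      have hp := h.prod_pos (k := k) (by omega)
      refine mul_le_mul_of_nonneg_left ?_ hp.le
      rwa [show ((m + 1 : ℕ) : ℝ) + 1 = m + 2 by push_cast; ring] at this

lemma prod_ge_half (h : ProductSum (d + 2) x) :
    (∏ i ∈ range d, x i) * ((1 - ∑ i ∈ range d, x i) / 2) ≤ ∏ i ∈ range (d + 1), x i := by
  rw [prod_range_succ]
  have hp := h.prod_pos (k := d) (by omega)
  have hs := h.sum_eq
  rw [sum_range_succ, sum_range_succ] at hs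
  have := h.anti d (by omega)
  gcongr
  linarith

lemma good_or_lt (h : ProductSum (d + 2) x) (hd : 4 ≤ d + 1) :
    1 - ∑ i ∈ range d, x i ≤ x (d - 1) ∨
      headTail d 1 < (∏ i ∈ range d, x i) * ((1 - ∑ i ∈ range d, x i) / 2) := by
  obtain ⟨k, rfl⟩ : ∃ k, d = k + 1 := ⟨d - 1, by omega⟩
  rcases le_total (1 - ∑ i ∈ range (k + 1), x i) (x k) with hg | hb
  · exact Or.inl hg
  · right
    refine (h.headTail_lt_prod hd k 1 le_rfl (by omega)).trans_le ?_
    have hle := h.tail_le (k := k) (m := 2) (by omega)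
    have := pow_div_le_mul_pow_div (m := 1) (h.pos k (by omega)) (by simpa using hb) (by
        push_cast at hle ⊢; linarith)
    have e : x k + (1 - ∑ i ∈ range (k + 1), x i) = 1 - ∑ i ∈ range k, x i := by
      rw [sum_range_succ]; ring
    rw [e] at this
    rw [prod_range_succ, mul_assoc]
    have hp := h.prod_pos (k := k) (by omega)
    refine mul_le_mul_of_nonneg_left ?_ hp.le
    norm_num at this ⊢
    exact this

/-- The product of all but the smallest coordinate is minimal at the Sylvester point. -/
theorem prod_ge (h : ProductSum (d + 2) x) (hd : 4 ≤ d + 1) :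
    1 / (2 * sylvProd d ^ 2) ≤ ∏ i ∈ range (d + 1), x i := by
  have e : headTail d 1 = 1 / (2 * sylvProd d ^ 2) := by rw [headTail]; norm_num
  refine le_trans ?_ h.prod_ge_half
  rcases h.good_or_lt hd with hg | hb
  · obtain ⟨k, rfl⟩ : ∃ k, d = k + 1 := ⟨d - 1, by omega⟩
    have := h.one_div_le_prod_mul_tail (k := k) (m := 1) (by omega) (by simpa using hg)
    rw [pow_one, one_add_one_eq_two] at this
    rw [← mul_div_assoc, one_div, mul_inv_rev, ← one_div, ← div_eq_mul_inv]
    gcongr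
  · exact e ▸ hb.le

theorem eq_of_prod_eq (h : ProductSum (d + 2) x) (hd : 4 ≤ d + 1)
    (heq : ∏ i ∈ range (d + 1), x i = 1 / (2 * sylvProd d ^ 2)) :
    (∀ i < d, x i = 1 / sylv i) ∧ x d = 1 / (2 * sylvProd d) ∧
      x (d + 1) = 1 / (2 * sylvProd d) := by
  have e : headTail d 1 = 1 / (2 * sylvProd d ^ 2) := by rw [headTail]; norm_num
  have hhalf := h.prod_ge_half
  have hN := one_le_sylvProd d
  have hx : ∀ i < d, x i = 1 / sylv i := by
    rcases h.good_or_lt hd with hg | hb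
    · obtain ⟨k, rfl⟩ : ∃ k, d = k + 1 := ⟨d - 1, by omega⟩
      refine h.eq_of_prod_mul_tail_le (k := k) (m := 1) (by omega) (by simpa using hg) ?_
      rw [pow_one, one_add_one_eq_two]
      rw [heq, ← mul_div_assoc, one_div, mul_inv_rev, ← one_div, ← div_eq_mul_inv] at hhalf
      linarith
    · linarith
  have hs := h.sum_eq
  have hsum : ∑ i ∈ range d, x i = 1 - 1 / sylvProd d := by
    rw [← sum_inv_sylv]; exact sum_congr rfl fun i hi => hx i (mem_range.1 hi)
  have hprod : ∏ i ∈ range d, x i = 1 / sylvProd d := by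
    rw [prod_congr rfl fun i hi => hx i (mem_range.1 hi), prod_div_distrib, prod_sylv,
      prod_const_one]
  rw [sum_range_succ, sum_range_succ, hsum] at hs
  rw [prod_range_succ, hprod] at heq
  have hxd : x d = 1 / (2 * sylvProd d) := by
    have : x d = sylvProd d * (1 / sylvProd d * x d) := by field_simp
    rw [this, heq]; field_simp
  refine ⟨hx, hxd, ?_⟩
  have : 1 / sylvProd d = 1 / (2 * sylvProd d) + 1 / (2 * sylvProd d) := by field_simp; norm_num
  linarith

end ProductSum

section Blichfeldt

open MeasureTheory

variable {ι : Type*} [Fintype ι] [DecidableEq ι]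

/-- Blichfeldt's principle for the lattice spanned by the rows of a matrix. -/
lemma exists_int_vecMul_sub_eq (M : Matrix (ι) (ι) ℝ) (hM : M.det ≠ 0)
    {S : Set (ι → ℝ)} (hS : MeasurableSet S) (hvol : ENNReal.ofReal |M.det| < volume S) :
    ∃ z : ι → ℤ, z ≠ 0 ∧ ∃ s ∈ S, ∃ s' ∈ S, s - s' = Matrix.vecMul (fun i => (z i : ℝ)) M := by
  have hli : LinearIndependent ℝ M.row :=
    Matrix.linearIndependent_rows_of_det_ne_zero hM
  let b : Module.Basis (ι) ℝ (ι → ℝ) :=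
    basisOfLinearIndependentOfCardEqFinrank' M.row hli (by simp)
  have hb : (b : ι → ι → ℝ) = M.row := by simp [b]
  have hbM : Matrix.of (b : ι → ι → ℝ) = M := by rw [hb]; rfl
  have hfd := ZSpan.volume_fundamentalDomain b
  rw [hbM] at hfd
  have : Countable (Submodule.span ℤ (Set.range b)).toAddSubgroup :=
    inferInstanceAs (Countable (Submodule.span ℤ (Set.range b)))
  obtain ⟨x, y, hxy, hnd⟩ := exists_pair_mem_lattice_not_disjoint_vadd
    (ZSpan.isAddFundamentalDomain' b volume) hS.nullMeasurableSet (hfd ▸ hvol)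
  rw [Set.not_disjoint_iff] at hnd
  obtain ⟨p, ⟨s, hs, hsp⟩, ⟨s', hs', hsp'⟩⟩ := hnd
  have hmem : ((y - x : (Submodule.span ℤ (Set.range b)).toAddSubgroup) : ι → ℝ) ∈
    Submodule.span ℤ (Set.range b) := (y - x).2
  obtain ⟨z, hz⟩ := (Submodule.mem_span_range_iff_exists_fun ℤ).1 hmem
  have hss : s - s' = ((y - x : (Submodule.span ℤ (Set.range b)).toAddSubgroup) : ι → ℝ) := by
    have h1 : (x : ι → ℝ) + s = p := hsp
    have h2 : (y : ι → ℝ) + s' = p := hsp'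
    rw [AddSubgroup.coe_sub, sub_eq_sub_iff_add_eq_add, add_comm, h1, h2]
  refine ⟨z, ?_, s, hs, s', hs', ?_⟩
  · rintro rfl
    apply hxy
    simp only [Pi.zero_apply, zero_smul, Finset.sum_const_zero] at hz
    have : y - x = 0 := Subtype.ext hz.symm
    exact (sub_eq_zero.1 this).symm
  · rw [hss, ← hz, hb]
    ext j
    simp [Matrix.vecMul, dotProduct, Finset.sum_apply, Matrix.row]

/-- Minkowski's theorem on linear forms. -/
lemma exists_int_abs_vecMul_lt (M : Matrix (ι) (ι) ℝ) (hM : M.det ≠ 0)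
    {c : ι → ℝ} (hc : ∀ i, 0 ≤ c i) (hvol : |M.det| < ∏ i, c i) :
    ∃ z : ι → ℤ, z ≠ 0 ∧ ∀ i, |Matrix.vecMul (fun i => (z i : ℝ)) M i| < c i := by
  obtain ⟨z, hz, s, hs, s', hs', h⟩ := exists_int_vecMul_sub_eq M hM
    (S := Set.univ.pi fun i => Set.Ico 0 (c i))
    (MeasurableSet.univ_pi fun i => measurableSet_Ico) (by
      rw [Real.volume_pi_Ico, ← ENNReal.ofReal_prod_of_nonneg (fun i _ => by simpa using hc i)]
      simpa using ENNReal.ofReal_lt_ofReal_iff'.2 ⟨hvol, (abs_nonneg _).trans_lt hvol⟩)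
  refine ⟨z, hz, fun i => ?_⟩
  have h1 := hs i trivial
  have h2 := hs' i trivial
  rw [← h, Pi.sub_apply, abs_lt]
  constructor <;> linarith [h1.1, h1.2, h2.1, h2.2]

end Blichfeldt

section SimplexVolume

open MeasureTheory

/-- The corner simplex `{x ≥ 0, ∑ x ≤ r}`. -/
def cornerSimplex (n : ℕ) (r : ℝ) : Set (Fin n → ℝ) := {x | (∀ i, 0 ≤ x i) ∧ ∑ i, x i ≤ r}

lemma isClosed_cornerSimplex (n : ℕ) (r : ℝ) : IsClosed (cornerSimplex n r) := by
  refine IsClosed.inter ?_ ?_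
  · exact isClosed_Ici (a := (0 : Fin n → ℝ))
  · exact isClosed_le (f := fun x : Fin n → ℝ => ∑ i, x i) (by fun_prop) continuous_const

lemma volume_cornerSimplex (n : ℕ) {r : ℝ} (hr : 0 ≤ r) :
    volume (cornerSimplex n r) = ENNReal.ofReal (r ^ n / n.factorial) := by
  induction n generalizing r with
  | zero =>
    have : cornerSimplex 0 r = Set.univ := by ext x; simp [cornerSimplex, hr]
    rw [this, volume_pi, Measure.pi_univ]
    simp
  | succ n ih =>
    have hmp := (volume_preserving_piFinSuccAbove (fun _ : Fin (n + 1) => ℝ) 0).symm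
    rw [← hmp.measure_preimage_equiv, Measure.volume_eq_prod,
      Measure.prod_apply ((MeasurableEquiv.measurable _)
        (isClosed_cornerSimplex _ _).measurableSet)]
    have hfib : ∀ a : ℝ, volume (Prod.mk a ⁻¹'
        ((MeasurableEquiv.piFinSuccAbove (fun _ : Fin (n + 1) => ℝ) 0).symm ⁻¹'
          cornerSimplex (n + 1) r)) =
        (Set.Icc 0 r).indicator (fun a => ENNReal.ofReal ((r - a) ^ n / n.factorial)) a := by
      intro a
      have hset : (Prod.mk a ⁻¹' ((MeasurableEquiv.piFinSuccAbove (fun _ : Fin (n + 1) => ℝ) 0).symm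
          ⁻¹' cornerSimplex (n + 1) r)) = {y | 0 ≤ a ∧ y ∈ cornerSimplex n (r - a)} := by
        ext y
        simp only [Set.mem_preimage, cornerSimplex, MeasurableEquiv.piFinSuccAbove_symm_apply,
          Fin.insertNthEquiv_zero, Fin.forall_fin_succ, Fin.sum_univ_succ]
        constructor
        · rintro ⟨⟨h0, h1⟩, h2⟩
          exact ⟨h0, h1, le_sub_iff_add_le'.2 h2⟩
        · rintro ⟨h0, h1, h2⟩
          exact ⟨⟨h0, h1⟩, le_sub_iff_add_le'.1 h2⟩
      rw [hset]
      by_cases ha : a ∈ Set.Icc 0 r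
      · rw [Set.indicator_of_mem ha, ← ih (by linarith [ha.2])]
        simp [ha.1]
      · rw [Set.indicator_of_notMem ha]
        convert measure_empty (μ := volume)
        ext y
        simp only [cornerSimplex, Set.mem_empty_iff_false, iff_false]
        rintro ⟨h0, h1, h2⟩
        exact ha ⟨h0, by linarith [Finset.sum_nonneg fun i (_ : i ∈ Finset.univ) => h1 i]⟩
    simp_rw [hfib]
    rw [lintegral_indicator measurableSet_Icc, ← ofReal_integral_eq_lintegral_ofReal]
    · rw [integral_Icc_eq_integral_Ioc, ← intervalIntegral.integral_of_le hr,
        intervalIntegral.integral_comp_sub_left (fun a => a ^ n / (n.factorial : ℝ))]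
      congr 1
      rw [intervalIntegral.integral_div, integral_pow, Nat.factorial_succ]
      push_cast
      field_simp
      simp
    · exact ((by fun_prop : Continuous fun a : ℝ => (r - a) ^ n / (n.factorial : ℝ))).integrableOn_Icc
    · filter_upwards [ae_restrict_mem measurableSet_Icc] with a ha
      have : 0 ≤ r - a := by linarith [ha.2]
      positivity

end SimplexVolume

section Edges

open MeasureTheory

variable {d : ℕ}

/-- The matrix with rows `v i - v d`. -/
def edgeMatrix (v : Fin (d + 1) → Fin d → ℤ) : Matrix (Fin d) (Fin d) ℤ :=
  Matrix.of fun i j => v i.castSucc j - v (Fin.last d) j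

/-- The real matrix with rows `v i - v d`. -/
noncomputable def edgeMatrixR (v : Fin (d + 1) → Fin d → ℤ) : Matrix (Fin d) (Fin d) ℝ :=
  (edgeMatrix v).map fun n : ℤ => (n : ℝ)

lemma det_edgeMatrixR (v : Fin (d + 1) → Fin d → ℤ) :
    (edgeMatrixR v).det = ((edgeMatrix v).det : ℝ) := by
  exact ((Int.castRingHom ℝ).map_det (edgeMatrix v)).symm

lemma sum_smul_toR (v : Fin (d + 1) → Fin d → ℤ) (l : Fin (d + 1) → ℝ) (hl : ∑ i, l i = 1) :
    ∑ i, l i • toR (v i) =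
      toR (v (Fin.last d)) + Matrix.vecMul (fun i => l i.castSucc) (edgeMatrixR v) := by
  rw [Fin.sum_univ_castSucc] at hl ⊢
  have : l (Fin.last d) = 1 - ∑ i : Fin d, l i.castSucc := by linarith
  rw [this]
  ext j
  simp only [toR, edgeMatrixR, edgeMatrix, Matrix.vecMul, dotProduct, Pi.add_apply,
    Finset.sum_apply, Pi.smul_apply, smul_eq_mul, Matrix.map_apply, Matrix.of_apply, Int.cast_sub,
    mul_sub, Finset.sum_sub_distrib, ← Finset.sum_mul]
  ring

lemma hullOf_eq (v : Fin (d + 1) → Fin d → ℤ) :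
    hullOf v = (fun x => toR (v (Fin.last d)) + Matrix.vecMul x (edgeMatrixR v)) ''
      cornerSimplex d 1 := by
  ext p
  rw [hullOf, convexHull_range_eq_exists_affineCombination]
  constructor
  · rintro ⟨s, w, hw0, hw1, rfl⟩
    classical
    set l : Fin (d + 1) → ℝ := fun i => if i ∈ s then w i else 0 with hl
    have hl1 : ∑ i, l i = 1 := by rw [← hw1]; simp [hl]
    have hl0 : ∀ i, 0 ≤ l i := fun i => by
      simp only [hl]; split_ifs with h
      · exact hw0 i h
      · exact le_rfl
    refine ⟨fun i => l i.castSucc, ⟨fun i => hl0 _, ?_⟩, ?_⟩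
    · rw [Fin.sum_univ_castSucc] at hl1
      linarith [hl0 (Fin.last d)]
    · simp only
      rw [← sum_smul_toR v l hl1, Finset.affineCombination_eq_linear_combination _ _ _ hw1]
      simp [hl, ite_smul]
  · rintro ⟨x, ⟨hx0, hx1⟩, rfl⟩
    set l : Fin (d + 1) → ℝ := Fin.snoc x (1 - ∑ i, x i) with hl
    have hl1 : ∑ i, l i = 1 := by simp [hl, Fin.sum_univ_castSucc]
    refine ⟨Finset.univ, l, ?_, hl1, ?_⟩
    · intro i _
      refine Fin.lastCases ?_ (fun j => ?_) i
      · simp [hl, hx1]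
      · simp [hl, hx0]
    · rw [Finset.affineCombination_eq_linear_combination _ _ _ hl1, sum_smul_toR v l hl1]
      simp [hl]

lemma volume_hullOf (v : Fin (d + 1) → Fin d → ℤ) :
    (d.factorial : ℝ) * (volume (hullOf v)).toReal = |((edgeMatrix v).det : ℝ)| := by
  have himg : hullOf v = (fun y => toR (v (Fin.last d)) + y) ''
      (Matrix.toLin' (edgeMatrixR v).transpose '' cornerSimplex d 1) := by
    rw [hullOf_eq, Set.image_image]
    simp [Matrix.mulVec_transpose]
  rw [himg, Set.image_add_left, measure_preimage_add, Measure.addHaar_image_linearMap,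
    LinearMap.det_toLin', Matrix.det_transpose, volume_cornerSimplex d zero_le_one, det_edgeMatrixR,
    ENNReal.toReal_mul, ENNReal.toReal_ofReal (abs_nonneg _), ENNReal.toReal_ofReal (by positivity)]
  have : (d.factorial : ℝ) ≠ 0 := by positivity
  field_simp
  simp

end Edges

section Barycentric

variable {d : ℕ}

lemma mem_interior_hullOf {v : Fin (d + 1) → Fin d → ℤ}
    (hv : AffineIndependent ℝ fun i => toR (v i)) (x : Fin d → ℝ) :
    x ∈ interior (hullOf v) ↔
      ∃ l : Fin (d + 1) → ℝ, (∀ i, 0 < l i) ∧ ∑ i, l i = 1 ∧ ∑ i, l i • toR (v i) = x := by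
  let b : AffineBasis (Fin (d + 1)) ℝ (Fin d → ℝ) :=
    ⟨fun i => toR (v i), hv, by
      rw [hv.affineSpan_eq_top_iff_card_eq_finrank_add_one]; simp⟩
  have hb : interior (hullOf v) = {x | ∀ i, 0 < b.coord i x} := b.interior_convexHull
  rw [hb]
  constructor
  · intro hx
    refine ⟨fun i => b.coord i x, hx, b.sum_coord_apply_eq_one x, ?_⟩
    exact b.linear_combination_coord_eq_self x
  · rintro ⟨l, hl0, hl1, rfl⟩ i
    have : ∑ i, l i • toR (v i) = Finset.univ.affineCombination ℝ b l :=
      (Finset.affineCombination_eq_linear_combination _ _ _ hl1).symm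
    rw [this, b.coord_apply_combination_of_mem (Finset.mem_univ i) hl1]
    exact hl0 i

lemma det_edgeMatrix_ne_zero {v : Fin (d + 1) → Fin d → ℤ}
    (hv : AffineIndependent ℝ fun i => toR (v i)) : (edgeMatrixR v).det ≠ 0 := by
  rw [affineIndependent_iff_linearIndependent_vsub ℝ _ (Fin.last d)] at hv
  have h2 := hv.comp (fun i : Fin d => (⟨i.castSucc, (Fin.castSucc_lt_last i).ne⟩ :
    {x // x ≠ Fin.last d})) fun i j hij => by simpa using hij
  have h3 : LinearIndependent ℝ (edgeMatrixR v).row := by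
    have e : (edgeMatrixR v).row = fun i : Fin d => toR (v i.castSucc) -ᵥ toR (v (Fin.last d)) := by
      ext i j
      simp [edgeMatrixR, edgeMatrix, toR, Matrix.row]
    rw [e]
    exact h2
  rw [← isUnit_iff_ne_zero, ← Matrix.isUnit_iff_isUnit_det]
  exact Matrix.linearIndependent_rows_iff_isUnit.1 h3

/-- `β` are the barycentric coordinates of the origin in the canonical simplex with vertices `v`. -/
structure IsCanonicalWith (v : Fin (d + 1) → Fin d → ℤ) (β : Fin (d + 1) → ℝ) : Prop where
  pos : ∀ i, 0 < β i
  sum_eq : ∑ i, β i = 1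
  comb_eq : ∑ i, β i • toR (v i) = 0
  det_ne : (edgeMatrixR v).det ≠ 0
  eq_zero : ∀ (l : Fin (d + 1) → ℝ) (x : Fin d → ℤ), (∀ i, 0 < l i) → ∑ i, l i = 1 →
    ∑ i, l i • toR (v i) = toR x → x = 0

lemma IsCanonicalSimplex.exists_isCanonicalWith {v : Fin (d + 1) → Fin d → ℤ}
    (hv : IsCanonicalSimplex v) : ∃ β, IsCanonicalWith v β := by
  obtain ⟨hai, h0, huniq⟩ := hv
  obtain ⟨β, hpos, hsum, hcomb⟩ := (mem_interior_hullOf hai 0).1 h0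
  exact ⟨β, hpos, hsum, hcomb, det_edgeMatrix_ne_zero hai, fun l x hl0 hl1 hl =>
    huniq x ((mem_interior_hullOf hai _).2 ⟨l, hl0, hl1, hl⟩)⟩

lemma hullOf_comp_perm (v : Fin (d + 1) → Fin d → ℤ) (σ : Equiv.Perm (Fin (d + 1))) :
    hullOf (v ∘ σ) = hullOf v := by
  rw [hullOf, hullOf, ← σ.surjective.range_comp fun i => toR (v i)]; rfl

lemma IsCanonicalSimplex.comp_perm {v : Fin (d + 1) → Fin d → ℤ} (hv : IsCanonicalSimplex v)
    (σ : Equiv.Perm (Fin (d + 1))) : IsCanonicalSimplex (v ∘ σ) := by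
  obtain ⟨h1, h2, h3⟩ := hv
  refine ⟨h1.comp_embedding σ.toEmbedding, ?_, ?_⟩ <;> rwa [hullOf_comp_perm]

namespace IsCanonicalWith

variable {v : Fin (d + 1) → Fin d → ℤ} {β : Fin (d + 1) → ℝ}

lemma isUnit_det (h : IsCanonicalWith v β) : IsUnit (edgeMatrixR v).det :=
  isUnit_iff_ne_zero.2 h.det_ne

lemma last_add_eq_zero (h : IsCanonicalWith v β) :
    toR (v (Fin.last d)) + Matrix.vecMul (fun i => β i.castSucc) (edgeMatrixR v) = 0 := by
  rw [← sum_smul_toR v β h.sum_eq, h.comb_eq]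

lemma comb_eq_of_comb_eq_zero (h : IsCanonicalWith v β) {l : Fin (d + 1) → ℝ}
    (hl1 : ∑ i, l i = 1) (hl : ∑ i, l i • toR (v i) = 0) : l = β := by
  have h1 := h.last_add_eq_zero
  rw [sum_smul_toR v l hl1, ← h1, add_right_inj] at hl
  have hinj := Matrix.vecMul_injective_of_isUnit ((Matrix.isUnit_iff_isUnit_det _).2 h.isUnit_det)
  have h2 := hinj hl
  have h3 : ∀ i : Fin d, l i.castSucc = β i.castSucc := fun i => congrFun h2 i
  have hs := hl1.trans h.sum_eq.symm
  rw [Fin.sum_univ_castSucc, Fin.sum_univ_castSucc, Finset.sum_congr rfl fun i _ => h3 i,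
    add_right_inj] at hs
  ext i
  exact Fin.lastCases hs h3 i

/-- The linear parts of the barycentric coordinates, up to the last one, of a lattice vector. -/
noncomputable def coords (v : Fin (d + 1) → Fin d → ℤ) (z : Fin d → ℤ) : Fin d → ℝ :=
  Matrix.vecMul (toR z) (edgeMatrixR v)⁻¹

lemma coords_vecMul (h : IsCanonicalWith v β) (z : Fin d → ℤ) :
    Matrix.vecMul (coords v z) (edgeMatrixR v) = toR z := by
  rw [coords, Matrix.vecMul_vecMul, Matrix.nonsing_inv_mul _ h.isUnit_det, Matrix.vecMul_one]

lemma coords_neg (z : Fin d → ℤ) : coords v (-z) = -coords v z := by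
  have : toR (-z) = -toR z := by ext; simp [toR]
  rw [coords, this, Matrix.neg_vecMul, coords]

lemma eq_zero_of_coords (h : IsCanonicalWith v β) (z : Fin d → ℤ)
    (h1 : ∀ i : Fin d, -β i.castSucc < coords v z i)
    (h2 : ∑ i, coords v z i < β (Fin.last d)) : z = 0 := by
  set l : Fin (d + 1) → ℝ := Fin.snoc (fun i : Fin d => β i.castSucc + coords v z i)
    (β (Fin.last d) - ∑ i, coords v z i) with hl
  have hl1 : ∑ i, l i = 1 := by
    rw [← h.sum_eq, Fin.sum_univ_castSucc, Fin.sum_univ_castSucc β]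
    simp only [hl, Fin.snoc_castSucc, Fin.snoc_last, Finset.sum_add_distrib]
    ring
  refine h.eq_zero l z (fun i => ?_) hl1 ?_
  · refine Fin.lastCases ?_ (fun j => ?_) i
    · simp only [hl, Fin.snoc_last]; linarith
    · simp only [hl, Fin.snoc_castSucc]; linarith [h1 j]
  · have e : (fun i : Fin d => l i.castSucc) = (fun i => β i.castSucc) + coords v z := by
      ext i; simp [hl]
    rw [sum_smul_toR v l hl1, e, Matrix.add_vecMul, ← add_assoc, h.last_add_eq_zero,
      h.coords_vecMul, zero_add]

lemma eq_zero_of_abs_coords_lt (h : IsCanonicalWith v β) (z : Fin d → ℤ)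
    (h1 : ∀ i : Fin d, |coords v z i| < β i.castSucc) : z = 0 := by
  rcases le_total (∑ i, coords v z i) 0 with hs | hs
  · exact h.eq_zero_of_coords z (fun i => (abs_lt.1 (h1 i)).1) (hs.trans_lt (h.pos _))
  · refine neg_eq_zero.1 (h.eq_zero_of_coords (-z) (fun i => ?_) ?_)
    · rw [coords_neg, Pi.neg_apply]; linarith [(abs_lt.1 (h1 i)).2]
    · rw [coords_neg]
      simp only [Pi.neg_apply, Finset.sum_neg_distrib]
      linarith [h.pos (Fin.last d)]

lemma abs_det_inv (v : Fin (d + 1) → Fin d → ℤ) :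
    |(edgeMatrixR v)⁻¹.det| = 1 / |((edgeMatrix v).det : ℝ)| := by
  rw [Matrix.det_nonsing_inv, Ring.inverse_eq_inv', abs_inv, det_edgeMatrixR, one_div]

/-- The volume bound in terms of the barycentric coordinates of the origin. -/
lemma abs_det_mul_prod_le (h : IsCanonicalWith v β) :
    |((edgeMatrix v).det : ℝ)| * ∏ i : Fin d, β i.castSucc ≤ 1 := by
  by_contra! hlt
  have hdet : 0 < |((edgeMatrix v).det : ℝ)| := by
    rw [← det_edgeMatrixR]; exact abs_pos.2 h.det_ne
  obtain ⟨z, hz, hz'⟩ := exists_int_abs_vecMul_lt (edgeMatrixR v)⁻¹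
    (by rw [Matrix.det_nonsing_inv, Ring.inverse_eq_inv']; exact inv_ne_zero h.det_ne)
    (c := fun i => β i.castSucc) (fun i => (h.pos _).le)
    (by rw [abs_det_inv, div_lt_iff₀ hdet, mul_comm]; exact hlt)
  exact hz (h.eq_zero_of_abs_coords_lt z hz')

/-- The product-sum inequalities for the barycentric coordinates of the origin. -/
lemma prod_le_one_sub_sum (h : IsCanonicalWith v β) (I : Finset (Fin (d + 1)))
    (hI : I ≠ Finset.univ) : ∏ i ∈ I, β i ≤ 1 - ∑ i ∈ I, β i := by
  classical
  by_contra! hlt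
  obtain ⟨p, hp⟩ : ∃ p, p ∉ I := by
    by_contra! hall
    exact hI (Finset.eq_univ_iff_forall.2 hall)
  have hσ : 0 < 1 - ∑ i ∈ I, β i := by
    rw [← h.sum_eq, sub_pos]
    exact Finset.sum_lt_sum_of_subset (Finset.subset_univ I) (Finset.mem_univ p) hp (h.pos p)
      fun j _ _ => (h.pos j).le
  let B : Matrix Unit I ℝ := Matrix.of fun _ j => β j
  let C : Matrix I Unit ℝ := Matrix.of fun _ _ => -1
  let M : Matrix (Unit ⊕ I) (Unit ⊕ I) ℝ := Matrix.fromBlocks 1 B C (-1)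
  have hdet : |M.det| = 1 - ∑ i ∈ I, β i := by
    have hinv : Invertible (-1 : Matrix I I ℝ) := ⟨-1, by simp, by simp⟩
    have e : ⅟(-1 : Matrix I I ℝ) = -1 := invOf_eq_right_inv (by simp)
    have hBC : B * C = Matrix.of fun _ _ => -∑ i ∈ I, β i := by
      ext a b
      simp only [B, C, Matrix.mul_apply, Matrix.of_apply, mul_neg, mul_one,
        Finset.sum_neg_distrib]
      rw [← Finset.sum_coe_sort I]
    have e2 : ((1 : Matrix Unit Unit ℝ) - B * (-1 : Matrix I I ℝ) * C).det =
        1 - ∑ i ∈ I, β i := by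
      rw [Matrix.mul_neg, Matrix.mul_one, Matrix.neg_mul, sub_neg_eq_add, hBC,
        Matrix.det_unique]
      simp [sub_eq_add_neg]
    have e3 : |(-1 : Matrix I I ℝ).det| = 1 := by
      rw [Matrix.det_neg, Matrix.det_one]; simp
    rw [Matrix.det_fromBlocks₂₂, e, abs_mul, e2, e3, one_mul, abs_of_pos hσ]
  have hM0 : M.det ≠ 0 := by
    intro h0; rw [h0, abs_zero] at hdet; exact hσ.ne hdet
  obtain ⟨z, hz, hz'⟩ : ∃ z : Unit ⊕ I → ℤ, z ≠ 0 ∧ ∀ i,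
      |Matrix.vecMul (fun i => (z i : ℝ)) M i| < Sum.elim (fun _ => 1) (fun j : I => β j) i := by
    refine exists_int_abs_vecMul_lt M hM0 (fun i => ?_) ?_
    · rcases i with i | i
      · exact zero_le_one
      · exact (h.pos _).le
    · rw [hdet, Fintype.prod_sum_type]
      simp only [Sum.elim_inl, Sum.elim_inr, Finset.prod_const_one, one_mul]
      rwa [Finset.prod_coe_sort I fun i => β i]
  obtain ⟨z, hz, hz', hK⟩ : ∃ z : Unit ⊕ I → ℤ, z ≠ 0 ∧ (∀ i,
      |Matrix.vecMul (fun i => (z i : ℝ)) M i| < Sum.elim (fun _ => 1) (fun j : I => β j) i) ∧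
      0 ≤ z (Sum.inl ()) := by
    rcases le_total 0 (z (Sum.inl ())) with h0 | h0
    · exact ⟨z, hz, hz', h0⟩
    · refine ⟨-z, neg_ne_zero.2 hz, fun i => ?_, by simpa using h0⟩
      rw [show (fun i => (((-z) i : ℤ) : ℝ)) = -fun i => (z i : ℝ) by ext; simp,
        Matrix.neg_vecMul, Pi.neg_apply, abs_neg]
      exact hz' i
  set K : ℤ := z (Sum.inl ()) with hKdef
  have hform : ∀ i : I, |K * β i - z (Sum.inr i)| < β i := fun i => by
    have := hz' (Sum.inr i)
    simpa [M, B, C, Matrix.vecMul, dotProduct, Fintype.sum_sum_type, Matrix.one_apply, sub_eq_add_neg]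
      using this
  have hsum : K = ∑ i : I, z (Sum.inr i) := by
    have h1 := hz' (Sum.inl ())
    have h2 : |((K - ∑ i : I, z (Sum.inr i) : ℤ) : ℝ)| < 1 := by
      simpa [M, B, C, Matrix.vecMul, dotProduct, Fintype.sum_sum_type, Matrix.one_apply, sub_eq_add_neg]
        using h1
    have h3 : |K - ∑ i : I, z (Sum.inr i)| < 1 := by exact_mod_cast h2
    have := Int.abs_lt_one_iff.1 h3
    omega
  let m : Fin (d + 1) → ℤ := fun i => if hi : i ∈ I then z (Sum.inr ⟨i, hi⟩) else 0
  have hm : ∑ i, m i = K := by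
    rw [hsum, ← Finset.sum_subset (Finset.subset_univ I) fun i _ hi => by simp [m, hi],
      ← Finset.sum_coe_sort I]
    exact Finset.sum_congr rfl fun i _ => by simp [m]
  have hKr : (0 : ℝ) ≤ K := by exact_mod_cast hK
  have hmr : ∑ i, (m i : ℝ) = K := by exact_mod_cast hm
  have hl1 : ∑ i, ((K + 1) * β i - m i) = 1 := by
    rw [Finset.sum_sub_distrib, ← Finset.mul_sum, h.sum_eq, hmr]; ring
  have hcomb : ∑ i, ((K + 1) * β i - m i) • toR (v i) = toR (-∑ i, m i • v i) := by
    simp only [sub_smul, mul_smul, Finset.sum_sub_distrib, ← Finset.smul_sum, h.comb_eq]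
    ext j
    simp [toR, Finset.sum_apply]
  have hzero := h.eq_zero _ _ (fun i => ?_) hl1 hcomb
  · rw [hzero] at hcomb
    have h0 : toR (0 : Fin d → ℤ) = 0 := by ext; simp [toR]
    have hβ := h.comb_eq_of_comb_eq_zero hl1 (hcomb.trans h0)
    have hi : ∀ i, K * β i = m i := fun i => by
      have : (K + 1) * β i - m i = β i := congrFun hβ i
      linarith
    have hK0 : (K : ℝ) = 0 := by
      have := hi p
      simp only [m, hp, dif_neg, not_false_iff, Int.cast_zero] at this
      exact (mul_eq_zero.1 this).resolve_right (h.pos p).ne'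
    apply hz
    ext i
    rcases i with i | i
    · simpa using (show K = 0 by exact_mod_cast hK0)
    · have := hi i
      simp only [m, i.2, dif_pos, hK0, zero_mul] at this
      simpa using this.symm
  · by_cases hi : i ∈ I
    · have := (abs_lt.1 (hform ⟨i, hi⟩)).1
      simp only [m, hi, dif_pos]
      linarith
    · simp only [m, hi, dif_neg, not_false_iff, Int.cast_zero, sub_zero]
      have := h.pos i
      positivity

end IsCanonicalWith

end Barycentric

section Reduction

variable {d : ℕ} {v : Fin (d + 1) → Fin d → ℤ} {β : Fin (d + 1) → ℝ}

lemma IsCanonicalWith.comp_perm (h : IsCanonicalWith v β) (hv : IsCanonicalSimplex v)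
    (σ : Equiv.Perm (Fin (d + 1))) : IsCanonicalWith (v ∘ σ) (β ∘ σ) := by
  obtain ⟨β', h'⟩ := (hv.comp_perm σ).exists_isCanonicalWith
  have h1 : ∑ i, (β ∘ σ) i = 1 := (Equiv.sum_comp σ β).trans h.sum_eq
  have h2 : ∑ i, (β ∘ σ) i • toR ((v ∘ σ) i) = 0 :=
    (Equiv.sum_comp σ fun i => β i • toR (v i)).trans h.comb_eq
  rwa [h'.comb_eq_of_comb_eq_zero h1 h2]

lemma IsCanonicalSimplex.exists_antitone (hv : IsCanonicalSimplex v) :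
    ∃ (σ : Equiv.Perm (Fin (d + 1))) (β : Fin (d + 1) → ℝ),
      IsCanonicalWith (v ∘ σ) β ∧ Antitone β := by
  obtain ⟨β, h⟩ := hv.exists_isCanonicalWith
  refine ⟨Tuple.sort fun i => -β i, _, h.comp_perm hv _, fun i j hij => ?_⟩
  simpa using Tuple.monotone_sort (fun i => -β i) hij

/-- The extension of a finite tuple by zeros. -/
noncomputable def extendZero {n : ℕ} (β : Fin n → ℝ) (i : ℕ) : ℝ :=
  if h : i < n then β ⟨i, h⟩ else 0

lemma extendZero_val {n : ℕ} (β : Fin n → ℝ) (i : Fin n) : extendZero β i = β i := by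
  simp [extendZero]

lemma sum_range_extendZero {n : ℕ} (β : Fin n → ℝ) {k : ℕ} (hk : k ≤ n) :
    ∑ i ∈ Finset.range k, extendZero β i = ∑ i ∈ Finset.univ.map (Fin.castLEEmb hk), β i := by
  rw [Finset.sum_range, Finset.sum_map]
  exact Finset.sum_congr rfl fun i _ => extendZero_val β (Fin.castLE hk i)

lemma prod_range_extendZero {n : ℕ} (β : Fin n → ℝ) {k : ℕ} (hk : k ≤ n) :
    ∏ i ∈ Finset.range k, extendZero β i = ∏ i ∈ Finset.univ.map (Fin.castLEEmb hk), β i := by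
  rw [Finset.prod_range, Finset.prod_map]
  exact Finset.prod_congr rfl fun i _ => extendZero_val β (Fin.castLE hk i)

lemma IsCanonicalWith.productSum (h : IsCanonicalWith v β) (hβ : Antitone β) :
    ProductSum (d + 1) (extendZero β) where
  pos i hi := by simpa [extendZero, hi] using h.pos _
  anti i hi := by
    simp only [extendZero, hi, (Nat.lt_succ_self i).trans hi, dif_pos]
    exact hβ (Fin.mk_le_mk.2 (Nat.le_succ i))
  sum_eq := by
    rw [Finset.sum_range, ← h.sum_eq]
    exact Finset.sum_congr rfl fun i _ => extendZero_val β i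
  prod_le k _ hk := by
    rw [prod_range_extendZero β hk.le, sum_range_extendZero β hk.le]
    refine h.prod_le_one_sub_sum _ fun hu => hk.ne ?_
    simpa using congrArg Finset.card hu

end Reduction

section Extremal

open MeasureTheory

namespace IsCanonicalWith

variable {d : ℕ} {v : Fin (d + 1) → Fin d → ℤ} {β : Fin (d + 1) → ℝ}

lemma exists_int_abs_det_mul_coords (h : IsCanonicalWith v β) (z : Fin d → ℤ) (i : Fin d) :
    ∃ n : ℤ, |((edgeMatrix v).det : ℝ)| * coords v z i = n := by
  have h1 : ((edgeMatrix v).det : ℝ) * coords v z i =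
      (Matrix.vecMul z (edgeMatrix v).adjugate i : ℤ) := by
    have h2 := congrArg (fun x => Matrix.vecMul x (edgeMatrixR v).adjugate) (h.coords_vecMul z)
    simp only [Matrix.vecMul_vecMul, Matrix.mul_adjugate, Matrix.vecMul_smul,
      Matrix.vecMul_one, det_edgeMatrixR] at h2
    have h3 : (edgeMatrixR v).adjugate = (edgeMatrix v).adjugate.map fun n : ℤ => (n : ℝ) :=
      ((Int.castRingHom ℝ).map_adjugate (edgeMatrix v)).symm
    have h4 := congrFun h2 i
    rw [h3] at h4
    simpa [Matrix.vecMul, dotProduct, toR] using h4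
  rcases abs_choice ((edgeMatrix v).det : ℝ) with e | e
  · exact ⟨_, by rw [e, h1]⟩
  · exact ⟨-_, by rw [e, neg_mul, h1, Int.cast_neg]⟩

/-- In the extremal case the edge from the last vertex to the `k`-th one passes through a lattice
point. -/
lemma exists_coords_eq_single (h : IsCanonicalWith v β)
    (heq : |((edgeMatrix v).det : ℝ)| * ∏ i : Fin d, β i.castSucc = 1) (k : Fin d)
    (hk : β k.castSucc = β (Fin.last d))
    (hk_int : ∃ n : ℤ, |((edgeMatrix v).det : ℝ)| * β k.castSucc = n) :
    ∃ z, coords v z = Pi.single k (β k.castSucc) := by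
  set V := |((edgeMatrix v).det : ℝ)| with hV
  have hV0 : 0 < V := by
    rw [hV, ← det_edgeMatrixR]; exact abs_pos.2 h.det_ne
  set lo : Fin d → ℝ := Pi.single k (β k.castSucc) with hlo
  have hlo_int : ∀ i, ∃ n : ℤ, V * lo i = n := fun i => by
    by_cases hi : i = k
    · subst hi; simpa [hlo] using hk_int
    · exact ⟨0, by simp [hlo, hi]⟩
  set S₁ : Set (Fin d → ℝ) := Set.univ.pi fun i => Set.Ico 0 (β i.castSucc) with hS₁
  set S₂ : Set (Fin d → ℝ) := Set.univ.pi fun i => Set.Ico (lo i) (lo i + 1 / V) with hS₂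
  have hm₂ : MeasurableSet S₂ := MeasurableSet.univ_pi fun i => measurableSet_Ico
  have hdisj : Disjoint S₁ S₂ := by
    refine Set.disjoint_left.2 fun x h1 h2 => ?_
    have h3 := (h1 k trivial).2
    have h4 := (h2 k trivial).1
    simp only [hlo, Pi.single_eq_same] at h4
    exact h3.not_ge h4
  have hvol₁ : volume S₁ = ENNReal.ofReal |(edgeMatrixR v)⁻¹.det| := by
    rw [Real.volume_pi_Ico, ← ENNReal.ofReal_prod_of_nonneg fun i _ => by simpa using (h.pos _).le,
      abs_det_inv, ← hV, eq_comm]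
    simp only [sub_zero]
    rw [eq_div_of_mul_eq hV0.ne' ((mul_comm _ _).trans heq)]
  have hvol₂ : volume S₂ ≠ 0 := by
    rw [Real.volume_pi_Ico, Finset.prod_ne_zero_iff]
    intro i _
    simpa using hV0
  obtain ⟨z, hz, s, hs, s', hs', hzs⟩ := exists_int_vecMul_sub_eq (edgeMatrixR v)⁻¹
    (by rw [Matrix.det_nonsing_inv, Ring.inverse_eq_inv']; exact inv_ne_zero h.det_ne)
    (S := S₁ ∪ S₂) ((MeasurableSet.univ_pi fun i => measurableSet_Ico).union hm₂)
    (by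
      rw [measure_union hdisj hm₂, hvol₁]
      exact ENNReal.lt_add_right ENNReal.ofReal_ne_top hvol₂)
  have hle : ∀ z, ∀ i, coords v z i < lo i + 1 / V → coords v z i ≤ lo i := fun z i hlt => by
    obtain ⟨n, hn⟩ := h.exists_int_abs_det_mul_coords z i
    obtain ⟨l, hl⟩ := hlo_int i
    rw [← hV] at hn
    have h1 : V * coords v z i < V * lo i + 1 := by
      have := mul_lt_mul_of_pos_left hlt hV0
      rwa [mul_add, mul_one_div_cancel hV0.ne'] at this
    rw [hn, hl] at h1
    have h2 : n ≤ l := Int.lt_add_one_iff.1 (by exact_mod_cast h1)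
    refine le_of_mul_le_mul_left ?_ hV0
    rw [hn, hl]
    exact_mod_cast h2
  have key : ∀ z, z ≠ 0 → ∀ s ∈ S₂, ∀ s' ∈ S₁, s - s' = coords v z → coords v z = lo := by
    intro z hz s hs s' hs' hzs
    have h1 : ∀ i, lo i - β i.castSucc < coords v z i ∧ coords v z i ≤ lo i := fun i => by
      have e : s i - s' i = coords v z i := congrFun hzs i
      obtain ⟨a1, a2⟩ := hs i trivial
      obtain ⟨b1, b2⟩ := hs' i trivial
      exact ⟨by linarith, hle z i (by linarith)⟩
    have hlo0 : 0 ≤ lo := Pi.single_nonneg.2 (h.pos _).le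
    have hlosum : ∑ i, lo i = β (Fin.last d) := by rw [hlo, Finset.sum_pi_single', ← hk]; simp
    have hsum : ¬ ∑ i, coords v z i < ∑ i, lo i := fun hlt =>
      hz (h.eq_zero_of_coords z (fun i => by linarith [h1 i, show 0 ≤ lo i from hlo0 i]) (hlosum ▸ hlt))
    have hsum' := le_antisymm (Finset.sum_le_sum fun i _ => (h1 i).2) (not_lt.1 hsum)
    exact funext fun i =>
      (Finset.sum_eq_sum_iff_of_le fun i _ => (h1 i).2).1 hsum' i (Finset.mem_univ i)
  have hzs : s - s' = coords v z := hzs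
  rcases hs with hs | hs <;> rcases hs' with hs' | hs'
  · refine absurd (h.eq_zero_of_abs_coords_lt z fun i => ?_) hz
    have e : s i - s' i = coords v z i := congrFun hzs i
    obtain ⟨a1, a2⟩ := hs i trivial
    obtain ⟨b1, b2⟩ := hs' i trivial
    rw [← e, abs_lt]
    constructor <;> linarith
  · exact ⟨-z, key (-z) (neg_ne_zero.2 hz) s' hs' s hs (by rw [coords_neg, ← hzs, neg_sub])⟩
  · exact ⟨z, key z hz s hs s' hs' hzs⟩
  · refine absurd (h.eq_zero_of_abs_coords_lt z fun i => ?_) hz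
    have e : s i - s' i = coords v z i := congrFun hzs i
    obtain ⟨a1, a2⟩ := hs i trivial
    obtain ⟨b1, b2⟩ := hs' i trivial
    obtain ⟨n, hn⟩ := h.exists_int_abs_det_mul_coords z i
    rw [← hV] at hn
    have h1 : |coords v z i| < 1 / V := by rw [← e, abs_lt]; constructor <;> linarith
    have h2 : |(n : ℝ)| < 1 := by
      rw [← hn, abs_mul, abs_of_pos hV0]
      rwa [lt_div_iff₀' hV0] at h1
    have h3 : n = 0 := Int.abs_lt_one_iff.1 (by exact_mod_cast h2)
    rw [h3, Int.cast_zero] at hn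
    rw [(mul_eq_zero.1 hn).resolve_left hV0.ne', abs_zero]
    exact h.pos _

end IsCanonicalWith

lemma dvd_of_add_sum_div_eq_zero {ι : Type*} [Fintype ι] [DecidableEq ι] {s : ι → ℕ}
    (hs : ∀ i, s i ≠ 0) (hcop : Pairwise fun i j => Nat.Coprime (s i) (s j)) {n : ℤ} {w : ι → ℤ}
    (h : (n : ℝ) + ∑ i, (w i : ℝ) / s i = 0) (i : ι) : (s i : ℤ) ∣ w i := by
  have hP : ∀ i, (s i : ℤ) * ∏ j ∈ Finset.univ.erase i, (s j : ℤ) = ∏ j, (s j : ℤ) :=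
    fun i => Finset.mul_prod_erase _ (fun j => (s j : ℤ)) (Finset.mem_univ i)
  have h1 : n * ∏ j, (s j : ℤ) + ∑ i, w i * ∏ j ∈ Finset.univ.erase i, (s j : ℤ) = 0 := by
    have h2 : ((n * ∏ j, (s j : ℤ) + ∑ i, w i * ∏ j ∈ Finset.univ.erase i, (s j : ℤ) : ℤ) : ℝ) =
        ((n : ℝ) + ∑ i, (w i : ℝ) / s i) * ((∏ j, (s j : ℤ) : ℤ) : ℝ) := by
      rw [add_mul, Finset.sum_mul, Int.cast_add, Int.cast_mul, Int.cast_sum]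
      congr 1
      refine Finset.sum_congr rfl fun i _ => ?_
      have hi : (s i : ℝ) ≠ 0 := by exact_mod_cast hs i
      rw [← hP i]
      push_cast
      field_simp
    rw [h, zero_mul] at h2
    exact_mod_cast h2
  have h2 : (s i : ℤ) ∣ w i * ∏ j ∈ Finset.univ.erase i, (s j : ℤ) := by
    rw [← Finset.add_sum_erase _ _ (Finset.mem_univ i), add_left_comm] at h1
    rw [eq_neg_of_add_eq_zero_left h1]
    refine (dvd_neg.2 ((Dvd.dvd.mul_left ⟨_, (hP i).symm⟩ n).add
      (Finset.dvd_sum fun j hj => Dvd.dvd.mul_left ?_ _)))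
    exact Finset.dvd_prod_of_mem _ (Finset.mem_erase.2 ⟨(Finset.ne_of_mem_erase hj).symm,
      Finset.mem_univ i⟩)
  refine IsCoprime.dvd_of_dvd_mul_right (IsCoprime.prod_right fun j hj => ?_) h2
  exact Nat.isCoprime_iff_coprime.2 (hcop (Finset.ne_of_mem_erase hj).symm)

lemma sylv_coprime : Pairwise fun i j => Nat.Coprime (sylv i) (sylv j) := by
  have hprod : ∀ n, ∏ i ∈ Finset.range n, sylv i + 1 = sylv n := fun n => by
    have h : ((∏ i ∈ Finset.range n, sylv i + 1 : ℕ) : ℝ) = sylv n := by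
      rw [cast_sylv n, ← prod_sylv]; push_cast; rfl
    exact_mod_cast h
  have hlt : ∀ i j, i < j → Nat.Coprime (sylv i) (sylv j) := fun i j hij => by
    rw [← hprod j]
    obtain ⟨q, hq⟩ := Finset.dvd_prod_of_mem sylv (Finset.mem_range.2 hij)
    rw [hq]
    simp
  intro i j hij
  rcases lt_or_gt_of_ne hij with h | h
  · exact hlt i j h
  · exact (hlt j i h).symm

end Extremal

section Equivalence

open MeasureTheory

variable {d m : ℕ}

lemma UnimodEquiv.volume_eq {Q Q' : Set (Fin d → ℝ)} (h : UnimodEquiv Q Q') :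
    volume Q' = volume Q := by
  obtain ⟨A, w, hA, rfl⟩ := h
  have himg : (fun x => (A.map fun n : ℤ => (n : ℝ)).mulVec x + toR w) '' Q =
      (fun y => y + toR w) '' (Matrix.toLin' (A.map fun n : ℤ => (n : ℝ)) '' Q) := by
    rw [Set.image_image]; rfl
  have hdet : (A.map fun n : ℤ => (n : ℝ)).det = (A.det : ℝ) :=
    ((Int.castRingHom ℝ).map_det A).symm
  have habs : |(A.det : ℝ)| = 1 := by exact_mod_cast Int.isUnit_iff_abs_eq.1 hA
  rw [himg, Set.image_add_right, measure_preimage_add_right, Measure.addHaar_image_linearMap,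
    LinearMap.det_toLin', hdet, habs, ENNReal.ofReal_one, one_mul]

lemma UnimodEquiv.of_mulVec_eq {v v' : Fin (d + 1) → Fin d → ℤ} {A : Matrix (Fin d) (Fin d) ℤ}
    (hA : IsUnit A.det) (h : ∀ i, A.mulVec (v i) = v' i) : UnimodEquiv (hullOf v) (hullOf v') := by
  refine ⟨A, 0, hA, ?_⟩
  have h0 : toR (0 : Fin d → ℤ) = 0 := by ext; simp [toR]
  have himg := LinearMap.image_convexHull (Matrix.toLin' (A.map fun n : ℤ => (n : ℝ)))
    (Set.range fun i => toR (v i))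
  simp only [h0, add_zero]
  refine Eq.trans ?_ himg.symm
  rw [hullOf, ← Set.range_comp]
  congr 2
  ext i j
  simp [← h, toR, Matrix.mulVec, dotProduct]

/-- The edge lengths of the extremal simplex at its vertex `-(1,…,1)`. -/
def maxEdge (m : ℕ) : Fin (m + 1) → ℤ :=
  Fin.snoc (fun i : Fin m => (sylv i : ℤ)) (2 * ((sylv m : ℤ) - 1))

lemma maxEdge_castSucc (i : Fin m) : maxEdge m i.castSucc = sylv i := by
  rw [maxEdge, Fin.snoc_castSucc (α := fun _ => ℤ)]

lemma maxEdge_last : maxEdge m (Fin.last m) = 2 * ((sylv m : ℤ) - 1) := by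
  rw [maxEdge, Fin.snoc_last (α := fun _ => ℤ)]

lemma cast_prod_maxEdge : ((∏ i, maxEdge m i : ℤ) : ℝ) = 2 * sylvProd m ^ 2 := by
  rw [Fin.prod_univ_castSucc, maxEdge_last]
  simp only [maxEdge_castSucc]
  push_cast
  rw [← Finset.prod_range fun i => (sylv i : ℝ), prod_sylv, sylvProd]
  ring

lemma volMaxV_succ (i : Fin (m + 1)) : volMaxV (m + 1) i.succ = Pi.single i (maxEdge m i) - 1 := by
  ext j
  rw [volMaxV, Pi.sub_apply, Pi.one_apply, sub_left_inj]
  by_cases hj : j = i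
  · subst hj
    rw [if_pos (by simp), Pi.single_eq_same]
    refine Fin.lastCases ?_ (fun i => ?_) j
    · simp [maxEdge_last]
    · rw [maxEdge_castSucc, if_pos (by simp)]
      simp
  · rw [if_neg (by simpa [Fin.ext_iff] using hj), Pi.single_eq_of_ne hj]

lemma volMaxV_zero : volMaxV (m + 1) 0 = -1 := by
  ext j
  simp [volMaxV]

lemma volMaxV_finRotate_castSucc (i : Fin (m + 1)) :
    (volMaxV (m + 1) ∘ finRotate (m + 2)) i.castSucc = Pi.single i (maxEdge m i) - 1 := by
  rw [Function.comp_apply, finRotate_apply, Fin.coeSucc_eq_succ, volMaxV_succ]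

lemma volMaxV_finRotate_last :
    (volMaxV (m + 1) ∘ finRotate (m + 2)) (Fin.last (m + 1)) = -1 := by
  rw [Function.comp_apply, finRotate_last, volMaxV_zero]

lemma volume_hullOf_volMaxV :
    ((m + 1).factorial : ℝ) * (volume (hullOf (volMaxV (m + 1)))).toReal = 2 * sylvProd m ^ 2 := by
  have he : edgeMatrix (volMaxV (m + 1) ∘ finRotate (m + 2)) = Matrix.diagonal (maxEdge m) := by
    ext i j
    rw [edgeMatrix, Matrix.of_apply, volMaxV_finRotate_castSucc, volMaxV_finRotate_last,
      Matrix.diagonal_apply, Pi.sub_apply, Pi.single_apply]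
    simp [eq_comm]
  rw [← hullOf_comp_perm _ (finRotate (m + 2)), volume_hullOf, he, Matrix.det_diagonal,
    cast_prod_maxEdge, abs_of_nonneg (by positivity)]

namespace IsCanonicalWith

variable {v : Fin (m + 2) → Fin (m + 1) → ℤ} {β : Fin (m + 2) → ℝ}

/-- In the extremal case each edge at the last vertex is divisible by the extremal length. -/
lemma maxEdge_dvd (h : IsCanonicalWith v β)
    (hdet : |((edgeMatrix v).det : ℝ)| = 2 * sylvProd m ^ 2)
    (hβ : ∀ i : Fin (m + 1), β i.castSucc = 1 / maxEdge m i)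
    (hlast : β (Fin.last m).castSucc = β (Fin.last (m + 1))) (i j : Fin (m + 1)) :
    maxEdge m i ∣ edgeMatrix v i j := by
  have hN : 0 < sylvProd m := one_pos.trans_le (one_le_sylvProd m)
  have ha : (maxEdge m (Fin.last m) : ℝ) = 2 * sylvProd m := by
    rw [maxEdge_last, sylvProd]; push_cast; rfl
  obtain ⟨z, hz⟩ := h.exists_coords_eq_single
    (by
      rw [Finset.prod_congr rfl fun i _ => hβ i, Finset.prod_div_distrib, Finset.prod_const_one,
        ← Int.cast_prod, cast_prod_maxEdge, hdet]
      field_simp)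
    (Fin.last m) hlast
    ⟨(sylv m : ℤ) - 1, by
      rw [hdet, hβ, ha]
      push_cast
      rw [← sylvProd]
      field_simp⟩
  have hz' := h.coords_vecMul z
  rw [hz, hβ, Matrix.single_vecMul] at hz'
  have hlast_eq : ∀ j, edgeMatrix v (Fin.last m) j = maxEdge m (Fin.last m) * z j := fun j => by
    have h1 : 1 / (maxEdge m (Fin.last m) : ℝ) * (edgeMatrix v (Fin.last m) j : ℝ) = z j :=
      congrFun hz' j
    have h2 : (edgeMatrix v (Fin.last m) j : ℝ) = maxEdge m (Fin.last m) * z j := by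
      rw [← h1, ha]; field_simp
    exact_mod_cast h2
  have hsum : ((v (Fin.last (m + 1)) j + z j : ℤ) : ℝ) +
      ∑ i : Fin m, (edgeMatrix v i.castSucc j : ℝ) / sylv i = 0 := by
    have h1 : (v (Fin.last (m + 1)) j : ℝ) +
        ∑ i : Fin (m + 1), β i.castSucc * (edgeMatrix v i j : ℝ) = 0 :=
      congrFun h.last_add_eq_zero j
    rw [Fin.sum_univ_castSucc, hβ, hlast_eq, ha] at h1
    simp only [hβ, maxEdge_castSucc] at h1
    rw [← h1]
    push_cast
    rw [ha]
    field_simp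
    ring
  refine Fin.lastCases ⟨z j, hlast_eq j⟩ (fun i => ?_) i
  rw [maxEdge_castSucc]
  exact dvd_of_add_sum_div_eq_zero (fun i : Fin m => by have := two_le_sylv i; omega)
    (fun i j hij => sylv_coprime fun e => hij (Fin.ext e)) hsum i

lemma unimodEquiv_volMaxV (h : IsCanonicalWith v β)
    (hdet : |((edgeMatrix v).det : ℝ)| = 2 * sylvProd m ^ 2)
    (hβ : ∀ i : Fin (m + 1), β i.castSucc = 1 / maxEdge m i)
    (hlast : β (Fin.last m).castSucc = β (Fin.last (m + 1))) :
    UnimodEquiv (hullOf v) (hullOf (volMaxV (m + 1))) := by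
  choose U hU using h.maxEdge_dvd hdet hβ hlast
  have hE : edgeMatrix v = Matrix.diagonal (maxEdge m) * Matrix.of U := by
    ext i j
    rw [Matrix.diagonal_mul, hU, Matrix.of_apply]
  have hN : 0 < sylvProd m := one_pos.trans_le (one_le_sylvProd m)
  have hUdet : IsUnit (Matrix.of U).det := by
    rw [hE, Matrix.det_mul, Matrix.det_diagonal, Int.cast_mul, abs_mul, cast_prod_maxEdge,
      abs_of_pos (by positivity)] at hdet
    have h1 : |((Matrix.of U).det : ℝ)| = 1 := by
      refine mul_left_cancel₀ (show 2 * sylvProd m ^ 2 ≠ 0 by positivity) ?_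
      rw [hdet, mul_one]
    exact Int.isUnit_iff_abs_eq.2 (by exact_mod_cast h1)
  have hlast_eq : v (Fin.last (m + 1)) = Matrix.vecMul (-1) (Matrix.of U) := by
    ext j
    have h1 : (v (Fin.last (m + 1)) j : ℝ) +
        ∑ i : Fin (m + 1), β i.castSucc * (edgeMatrix v i j : ℝ) = 0 :=
      congrFun h.last_add_eq_zero j
    have h2 : ∀ i, β i.castSucc * (edgeMatrix v i j : ℝ) = U i j := fun i => by
      have hp := h.pos i.castSucc
      rw [hβ] at hp ⊢
      have : (maxEdge m i : ℝ) ≠ 0 := fun h0 => by simp [h0] at hp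
      rw [hU]
      push_cast
      field_simp
    rw [Finset.sum_congr rfl fun i _ => h2 i] at h1
    have h3 : v (Fin.last (m + 1)) j + ∑ i, U i j = 0 := by exact_mod_cast h1
    simp [Matrix.vecMul, dotProduct]
    linarith
  rw [← hullOf_comp_perm (volMaxV (m + 1)) (finRotate (m + 2))]
  refine UnimodEquiv.of_mulVec_eq (A := (Matrix.of U)⁻¹.transpose) ?_ fun i => ?_
  · rw [Matrix.det_transpose]
    exact Matrix.isUnit_nonsing_inv_det _ hUdet
  · have hcancel : ∀ x, Matrix.vecMul (Matrix.vecMul x (Matrix.of U)) (Matrix.of U)⁻¹ = x :=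
      fun x => by rw [Matrix.vecMul_vecMul, Matrix.mul_nonsing_inv _ hUdet, Matrix.vecMul_one]
    rw [Matrix.mulVec_transpose]
    refine Fin.lastCases ?_ (fun k => ?_) i
    · rw [volMaxV_finRotate_last, hlast_eq, hcancel]
    · have hk : v k.castSucc =
          Matrix.vecMul (Pi.single k (maxEdge m k) - 1) (Matrix.of U) := by
        rw [sub_eq_add_neg, Matrix.add_vecMul, ← hlast_eq, Matrix.single_vecMul]
        ext j
        have : v k.castSucc j - v (Fin.last (m + 1)) j = maxEdge m k * U k j := hU k j
        simp [Matrix.row]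
        linarith
      rw [volMaxV_finRotate_castSucc, hk, hcancel]

end IsCanonicalWith

end Equivalence

/-- For `d ≥ 4`, a `d`-dimensional canonical lattice simplex has normalized volume at
most `2 (s_d - 1)^2`, with equality iff it is unimodularly equivalent to
`conv{0, s_1 e_1, …, s_{d-1} e_{d-1}, 2(s_d - 1) e_d} - (1,…,1)`. -/
theorem canonical_simplex_volume {d : ℕ} (hd : 4 ≤ d)
    (v : Fin (d + 1) → Fin d → ℤ) (hv : IsCanonicalSimplex v) :
    (d.factorial : ℝ) * (MeasureTheory.volume (hullOf v)).toReal
        ≤ ((2 * (sylv (d - 1) - 1) ^ 2 : ℕ) : ℝ) ∧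
      ((d.factorial : ℝ) * (MeasureTheory.volume (hullOf v)).toReal
          = ((2 * (sylv (d - 1) - 1) ^ 2 : ℕ) : ℝ) ↔
        UnimodEquiv (hullOf v) (hullOf (volMaxV d))) := by
  obtain ⟨m, rfl⟩ : ∃ m, d = m + 1 := ⟨d - 1, by omega⟩
  obtain ⟨σ, β, h, hanti⟩ := hv.exists_antitone
  have hps := h.productSum hanti
  have hprod : ∏ i ∈ Finset.range (m + 1), extendZero β i = ∏ i : Fin (m + 1), β i.castSucc := by
    rw [Finset.prod_range]
    exact Finset.prod_congr rfl fun i _ => extendZero_val β i.castSucc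
  have hge := hps.prod_ge hd
  have hle := h.abs_det_mul_prod_le
  have hN : 0 < sylvProd m := one_pos.trans_le (one_le_sylvProd m)
  have hcast : ((2 * (sylv (m + 1 - 1) - 1) ^ 2 : ℕ) : ℝ) = 2 * sylvProd m ^ 2 := by
    have := two_le_sylv m
    rw [Nat.add_sub_cancel, sylvProd]
    push_cast [Nat.cast_sub (by omega : 1 ≤ sylv m)]
    rfl
  rw [hcast, ← hullOf_comp_perm v σ, volume_hullOf]
  rw [← hprod] at hle
  have hbound : |((edgeMatrix (v ∘ σ)).det : ℝ)| ≤ 2 * sylvProd m ^ 2 := by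
    have h1 := (mul_le_mul_of_nonneg_left hge (abs_nonneg _)).trans hle
    rwa [mul_one_div, div_le_one (by positivity)] at h1
  refine ⟨hbound, fun heq => ?_, fun hequiv => ?_⟩
  · have hprod_eq : ∏ i ∈ Finset.range (m + 1), extendZero β i = 1 / (2 * sylvProd m ^ 2) := by
      refine le_antisymm ?_ hge
      rw [heq] at hle
      rwa [le_div_iff₀' (by positivity)]
    obtain ⟨h1, h2, h3⟩ := hps.eq_of_prod_eq hd hprod_eq
    have hm : β (Fin.last m).castSucc = 1 / (2 * sylvProd m) :=
      (extendZero_val β (Fin.last m).castSucc).symm.trans h2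
    have hlast : β (Fin.last (m + 1)) = 1 / (2 * sylvProd m) :=
      (extendZero_val β (Fin.last (m + 1))).symm.trans h3
    refine h.unimodEquiv_volMaxV heq (fun i => ?_) (hm.trans hlast.symm)
    refine Fin.lastCases ?_ (fun i => ?_) i
    · rw [hm, maxEdge_last, sylvProd]; push_cast; rfl
    · rw [maxEdge_castSucc, Int.cast_natCast, ← h1 i i.2]
      exact (extendZero_val β i.castSucc.castSucc).symm
  · rw [← volume_hullOf, ← hequiv.volume_eq, volume_hullOf_volMaxV]
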